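/- Let T be a tree on the vertex set {1,…,n} in which vertex i has degree d_i. Then the number of distinct permutations arising as products of edge orderings of T equals the product of the factorials of the degrees: |C(T)| = ∏_{i=1}^{n} d_i!. (Theorem 2.3.) -/

import Mathlib

/-- The transposition of `Sₙ` corresponding to an edge (an unordered pair) of a graph
on the vertex set `Fin n`. -/
def edgePerm {n : ℕ} (e : Sym2 (Fin n)) : Equiv.Perm (Fin n) :=
  Sym2.lift ⟨fun i j => Equiv.swap i j, fun i j => Equiv.swap_comm i j⟩ e

/-- The product of the transpositions of a list of edges, the first edge applied first. -/
def listProd {n : ℕ} (l : List (Sym2 (Fin n))) : Equiv.Perm (Fin n) :=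
  (l.map edgePerm).reverse.prod

/-- `l` is an edge ordering of the graph `T`: a duplicate-free list containing
exactly the edges of `T`. -/
def IsEdgeOrdering {n : ℕ} (T : SimpleGraph (Fin n)) (l : List (Sym2 (Fin n))) : Prop :=
  l.Nodup ∧ ∀ e, e ∈ l ↔ e ∈ T.edgeSet

section EdgeOrderings

open SimpleGraph

variable {n : ℕ} {G : SimpleGraph (Fin n)}

@[simp]
lemma edgePerm_mk (i j : Fin n) : edgePerm s(i, j) = Equiv.swap i j := rfl

@[simp]
lemma listProd_nil : listProd ([] : List (Sym2 (Fin n))) = 1 := rfl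

lemma listProd_cons (e : Sym2 (Fin n)) (l : List (Sym2 (Fin n))) :
    listProd (e :: l) = listProd l * edgePerm e := by
  simp [listProd]

lemma listProd_append (l₁ l₂ : List (Sym2 (Fin n))) :
    listProd (l₁ ++ l₂) = listProd l₂ * listProd l₁ := by
  simp [listProd]

@[simp]
lemma edgePerm_edgePerm (e : Sym2 (Fin n)) (x : Fin n) : edgePerm e (edgePerm e x) = x := by
  induction e with
  | _ i j => simp

lemma edgePerm_of_notMem {e : Sym2 (Fin n)} {x : Fin n} (h : x ∉ e) : edgePerm e x = x := by
  induction e with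
  | _ i j =>
    simp only [Sym2.mem_iff, not_or] at h
    exact Equiv.swap_apply_of_ne_of_ne h.1 h.2

lemma mk_edgePerm_of_mem {e : Sym2 (Fin n)} {x : Fin n} (h : x ∈ e) :
    s(x, edgePerm e x) = e := by
  induction e with
  | _ i j =>
    rcases Sym2.mem_iff.1 h with rfl | rfl
    · simp
    · simp [Sym2.eq_swap]

lemma listProd_of_forall_notMem {l : List (Sym2 (Fin n))} {x : Fin n} (h : ∀ e ∈ l, x ∉ e) :
    listProd l x = x := by
  induction l with
  | nil => rfl
  | cons e l ih =>
    rw [List.forall_mem_cons] at h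
    rw [listProd_cons, Equiv.Perm.mul_apply, edgePerm_of_notMem h.1, ih h.2]

/-- The points whose trajectory passes through `v` when the transpositions of `l` are applied
one after the other. -/
def visitors (v : Fin n) : List (Sym2 (Fin n)) → Finset (Fin n)
  | [] => {v}
  | e :: l => insert v ((visitors v l).map (edgePerm e).toEmbedding)

lemma mem_visitors_cons {v x : Fin n} {e : Sym2 (Fin n)} {l : List (Sym2 (Fin n))} :
    x ∈ visitors v (e :: l) ↔ x = v ∨ edgePerm e x ∈ visitors v l := by
  simp only [visitors, Finset.mem_insert, Finset.mem_map, Equiv.coe_toEmbedding]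
  refine or_congr_right ⟨?_, fun h => ⟨_, h, edgePerm_edgePerm e x⟩⟩
  rintro ⟨y, hy, rfl⟩
  rwa [edgePerm_edgePerm]

lemma self_mem_visitors (v : Fin n) (l : List (Sym2 (Fin n))) : v ∈ visitors v l := by
  cases l <;> simp [visitors]

lemma mem_visitors_iff {v x : Fin n} {l : List (Sym2 (Fin n))} :
    x ∈ visitors v l ↔ ∃ l₁ l₂, l = l₁ ++ l₂ ∧ listProd l₁ x = v := by
  induction l generalizing x with
  | nil => simp [visitors]
  | cons e l ih =>
    rw [mem_visitors_cons, ih]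
    constructor
    · rintro (rfl | ⟨l₁, l₂, rfl, h⟩)
      · exact ⟨[], e :: l, rfl, rfl⟩
      · exact ⟨e :: l₁, l₂, rfl, by rwa [listProd_cons]⟩
    · rintro ⟨l₁, l₂, h, hx⟩
      cases l₁ with
      | nil => exact Or.inl hx
      | cons f l₁ =>
        obtain ⟨rfl, rfl⟩ := List.cons_eq_cons.1 h
        exact Or.inr ⟨l₁, l₂, rfl, by rwa [listProd_cons] at hx⟩

/-- The trajectory of a point under the transpositions of a list of edges, as a walk. -/
lemma exists_walk_listProd {l : List (Sym2 (Fin n))} (hl : ∀ e ∈ l, e ∈ G.edgeSet) (x : Fin n) :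
    ∃ p : G.Walk x (listProd l x), p.edges.Sublist l ∧
      ∀ v, v ∈ p.support ↔ x ∈ visitors v l := by
  induction l generalizing x with
  | nil => exact ⟨Walk.nil, by simp, fun v => by simp [visitors, eq_comm]⟩
  | cons e l ih =>
    rw [List.forall_mem_cons] at hl
    rw [listProd_cons, Equiv.Perm.mul_apply]
    simp only [mem_visitors_cons]
    by_cases hx : x ∈ e
    · have he := mk_edgePerm_of_mem hx
      have hadj : G.Adj x (edgePerm e x) := by
        rw [← mem_edgeSet, he]; exact hl.1
      obtain ⟨p, hp, hs⟩ := ih hl.2 (edgePerm e x)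
      refine ⟨p.cons hadj, ?_, fun v => ?_⟩
      · rw [Walk.edges_cons, he]
        exact hp.cons_cons e
      · rw [Walk.support_cons, List.mem_cons, hs, eq_comm]
    · rw [edgePerm_of_notMem hx]
      obtain ⟨p, hp, hs⟩ := ih hl.2 x
      refine ⟨p, hp.cons e, fun v => ?_⟩
      rw [hs]
      refine ⟨Or.inr, ?_⟩
      rintro (rfl | h)
      · exact self_mem_visitors _ _
      · exact h

lemma exists_isPath_listProd (hG : G.IsAcyclic) {l : List (Sym2 (Fin n))} (hnd : l.Nodup)
    (hl : ∀ e ∈ l, e ∈ G.edgeSet) (x : Fin n) :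
    ∃ p : G.Walk x (listProd l x), p.IsPath ∧ p.edges.Sublist l ∧
      ∀ v, v ∈ p.support ↔ x ∈ visitors v l := by
  obtain ⟨p, hp, hs⟩ := exists_walk_listProd hl x
  exact ⟨p, (hG.isPath_iff_isTrail p).2 ⟨hnd.sublist hp⟩, hp, hs⟩

/-- In a forest the visitors of a vertex depend on an ordering only through its product. -/
lemma visitors_eq_of_listProd_eq (hG : G.IsAcyclic) {l l' : List (Sym2 (Fin n))}
    (hl : IsEdgeOrdering G l) (hl' : IsEdgeOrdering G l') (h : listProd l = listProd l')
    (v : Fin n) : visitors v l = visitors v l' := by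
  ext x
  obtain ⟨p, hp, -, hs⟩ := exists_isPath_listProd hG hl.1 (fun e => (hl.2 e).1) x
  obtain ⟨q, hq, -, hs'⟩ := exists_isPath_listProd hG hl'.1 (fun e => (hl'.2 e).1) x
  rw [← hs, ← hs']
  have hpq : p.copy rfl (DFunLike.congr_fun h x) = q :=
    congrArg Subtype.val <| (hG.subsingleton_path _ _).elim
      ⟨_, (Walk.isPath_copy p rfl _).2 hp⟩ ⟨q, hq⟩
  rw [← hpq, Walk.support_copy]

lemma card_visitors (hG : G.IsAcyclic) {l : List (Sym2 (Fin n))} (hnd : l.Nodup)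
    (hl : ∀ e ∈ l, e ∈ G.edgeSet) (v : Fin n) :
    (visitors v l).card = l.countP (v ∈ ·) + 1 := by
  induction l with
  | nil => simp [visitors]
  | cons e l ih =>
    rw [List.forall_mem_cons] at hl
    rw [List.nodup_cons] at hnd
    have hmap : v ∈ (visitors v l).map (edgePerm e).toEmbedding ↔
        edgePerm e v ∈ visitors v l := by
      refine ⟨?_, fun h => Finset.mem_map.2 ⟨_, h, edgePerm_edgePerm e v⟩⟩
      intro h
      obtain ⟨y, hy, rfl⟩ := Finset.mem_map.1 h
      simpa using hy
    by_cases hv : v ∈ e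
    · have he := mk_edgePerm_of_mem hv
      have hadj : G.Adj v (edgePerm e v) := by
        rw [← mem_edgeSet, he]; exact hl.1
      have hnot : edgePerm e v ∉ visitors v l := by
        intro hmem
        obtain ⟨p, hp, hsub, hs⟩ := exists_isPath_listProd hG hnd.2 hl.2 (edgePerm e v)
        have hvp := (hs v).2 hmem
        have hpath : p.takeUntil v hvp = Path.singleton hadj.symm :=
          congrArg Subtype.val <| (hG.subsingleton_path _ _).elim
            ⟨_, hp.takeUntil hvp⟩ (Path.singleton hadj.symm)
        have hedge : e ∈ (p.takeUntil v hvp).edges := by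
          rw [hpath]
          simpa [Path.singleton, Sym2.eq_swap] using he.symm
        exact hnd.1 (hsub.subset (p.edges_takeUntil_subset_edges hvp hedge))
      rw [visitors, Finset.card_insert_of_notMem (hmap.not.2 hnot), Finset.card_map,
        ih hnd.2 hl.2, List.countP_cons_of_pos (by simpa using hv)]
    · have hmem : edgePerm e v ∈ visitors v l := by
        rw [edgePerm_of_notMem hv]; exact self_mem_visitors v l
      rw [visitors, Finset.insert_eq_of_mem (hmap.2 hmem), Finset.card_map,
        ih hnd.2 hl.2, List.countP_cons_of_neg (by simpa using hv)]

lemma exists_leaf (hG : G.IsAcyclic) (hne : G.edgeSet.Nonempty) :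
    ∃ u v, G.Adj u v ∧ ∀ w, G.Adj u w → w = v := by
  obtain ⟨e, he⟩ := hne
  induction e with
  | _ a b =>
    have : Nonempty (Fin n) := ⟨a⟩
    obtain ⟨u, v, p, hp, hmax⟩ := Walk.exists_isPath_forall_isPath_length_le_length G
    have hab : G.Adj a b := he
    have hlen := hmax _ _ _ (Path.singleton hab).2
    have hnil : ¬ p.Nil := by
      intro h
      rw [← Walk.length_eq_zero_iff] at h
      simp [Path.singleton, h] at hlen
    refine ⟨u, p.snd, p.adj_snd hnil, fun w hadj => hG.eq_snd_of_adj_start hp hadj ?_⟩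
    by_contra hw
    have := hmax _ _ _ (hp.cons (h := hadj.symm) hw)
    simp at this

/-- The products of the edge orderings of a graph. -/
def orderingProducts (G : SimpleGraph (Fin n)) : Set (Equiv.Perm (Fin n)) :=
  {c | ∃ l, IsEdgeOrdering G l ∧ listProd l = c}

lemma IsEdgeOrdering.deleteEdges {e : Sym2 (Fin n)} {l₁ l₂ : List (Sym2 (Fin n))}
    (h : IsEdgeOrdering G (l₁ ++ e :: l₂)) : IsEdgeOrdering (G.deleteEdges {e}) (l₁ ++ l₂) := by
  have hnd := List.nodup_middle.1 h.1
  rw [List.nodup_cons] at hnd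
  refine ⟨hnd.2, fun f => ?_⟩
  rw [edgeSet_deleteEdges, Set.mem_sdiff, ← h.2, Set.mem_singleton_iff]
  constructor
  · intro hf
    refine ⟨by simp only [List.mem_append, List.mem_cons] at hf ⊢; tauto, ?_⟩
    rintro rfl
    exact hnd.1 hf
  · simp only [List.mem_append, List.mem_cons]
    tauto

lemma IsEdgeOrdering.insert {e : Sym2 (Fin n)} (he : e ∈ G.edgeSet)
    {l₁ l₂ : List (Sym2 (Fin n))} (h : IsEdgeOrdering (G.deleteEdges {e}) (l₁ ++ l₂)) :
    IsEdgeOrdering G (l₁ ++ e :: l₂) := by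
  have hmem (f) : f ∈ l₁ ++ l₂ ↔ f ∈ G.edgeSet ∧ f ≠ e := by
    rw [h.2, edgeSet_deleteEdges, Set.mem_sdiff, Set.mem_singleton_iff]
  refine ⟨List.nodup_middle.2 (List.nodup_cons.2 ⟨fun h' => ((hmem e).1 h').2 rfl, h.1⟩),
    fun f => ?_⟩
  have := hmem f
  simp only [List.mem_append, List.mem_cons] at this ⊢
  by_cases hf : f = e
  · subst hf; simp [he]
  · tauto

lemma listProd_insert {u v x : Fin n} {l₁ l₂ : List (Sym2 (Fin n))}
    (hu : ∀ e ∈ l₁ ++ l₂, u ∉ e) (hx : listProd l₁ x = v) :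
    listProd (l₁ ++ s(u, v) :: l₂) = listProd (l₁ ++ l₂) * Equiv.swap u x := by
  have hu₁ : listProd l₁ u = u :=
    listProd_of_forall_notMem fun e he => hu e (List.mem_append_left _ he)
  rw [listProd_append, listProd_append, listProd_cons, edgePerm_mk, mul_assoc, mul_assoc,
    Equiv.mul_swap_eq_swap_mul, hu₁, hx]

/-- Deleting a pendant edge `s(u, v)` with leaf `u` from a forest divides the number of
products by one more than the remaining degree of `v`. -/
lemma ncard_orderingProducts_of_leaf (hG : G.IsAcyclic) {u v : Fin n} (huv : G.Adj u v)
    (hleaf : ∀ w, G.Adj u w → w = v) {l : List (Sym2 (Fin n))}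
    (hl : IsEdgeOrdering (G.deleteEdges {s(u, v)}) l) :
    (orderingProducts G).ncard =
      (orderingProducts (G.deleteEdges {s(u, v)})).ncard * (l.countP (v ∈ ·) + 1) := by
  classical
  set G' := G.deleteEdges {s(u, v)} with hG'
  have hacyc : G'.IsAcyclic := hG.anti (deleteEdges_le _)
  have hu {l'} (hl' : IsEdgeOrdering G' l') : ∀ e ∈ l', u ∉ e := by
    intro e he hue
    rw [hl'.2, hG', edgeSet_deleteEdges, Set.mem_sdiff, Set.mem_singleton_iff] at he
    obtain ⟨w, rfl⟩ := hue
    exact he.2 (by rw [hleaf w he.1])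
  let U (c : Equiv.Perm (Fin n)) : Finset (Fin n) :=
    Finset.univ.filter fun x => ∃ l', IsEdgeOrdering G' l' ∧ listProd l' = c ∧ x ∈ visitors v l'
  have hU {l'} (hl' : IsEdgeOrdering G' l') : U (listProd l') = visitors v l' := by
    ext x
    simp only [U, Finset.mem_filter, Finset.mem_univ, true_and]
    constructor
    · rintro ⟨l'', h, heq, hx⟩
      rwa [← visitors_eq_of_listProd_eq hacyc h hl' heq]
    · exact fun hx => ⟨l', hl', rfl, hx⟩
  let S := (orderingProducts G').toFinite.toFinset
  have hS {c} : c ∈ S ↔ ∃ l, IsEdgeOrdering G' l ∧ listProd l = c := by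
    rw [Set.Finite.mem_toFinset]; rfl
  have himage : orderingProducts G =
      ((S.sigma U).image fun y => y.1 * Equiv.swap u y.2 : Finset (Equiv.Perm (Fin n))) := by
    ext c
    simp only [Finset.coe_image, Set.mem_image, Finset.mem_coe, Finset.mem_sigma, hS]
    constructor
    · rintro ⟨l', hl', rfl⟩
      obtain ⟨l₁, l₂, rfl⟩ := List.append_of_mem ((hl'.2 s(u, v)).2 huv)
      have hdel := hl'.deleteEdges
      refine ⟨⟨listProd (l₁ ++ l₂), (listProd l₁).symm v⟩, ⟨⟨_, hdel, rfl⟩, ?_⟩, ?_⟩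
      · rw [hU hdel, mem_visitors_iff]
        exact ⟨l₁, l₂, rfl, by simp⟩
      · exact (listProd_insert (hu hdel) (by simp)).symm
    · rintro ⟨⟨c', x⟩, ⟨⟨l', hl', rfl⟩, hx⟩, rfl⟩
      rw [hU hl', mem_visitors_iff] at hx
      obtain ⟨l₁, l₂, rfl, hx⟩ := hx
      exact ⟨_, hl'.insert huv, listProd_insert (hu hl') hx⟩
  have hinj : Set.InjOn (fun y : (_ : Equiv.Perm (Fin n)) × Fin n => y.1 * Equiv.swap u y.2)
      (S.sigma U) := by
    rintro ⟨c, x⟩ hy ⟨c', x'⟩ hy' heq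
    simp only [Finset.mem_coe, Finset.mem_sigma, hS] at hy hy' heq
    obtain ⟨⟨l', hl', rfl⟩, -⟩ := hy
    obtain ⟨⟨l'', hl'', rfl⟩, -⟩ := hy'
    have hx : x = x' := by
      apply (listProd l' * Equiv.swap u x).injective
      conv_rhs => rw [heq]
      simp [listProd_of_forall_notMem (hu hl'), listProd_of_forall_notMem (hu hl'')]
    subst hx
    rw [mul_left_inj] at heq
    rw [heq]
  rw [himage, Set.ncard_coe_finset, Finset.card_image_of_injOn hinj, Finset.card_sigma,
    Set.ncard_eq_toFinset_card _ (orderingProducts G').toFinite, ← smul_eq_mul]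
  refine Finset.sum_const_nat fun c hc => ?_
  obtain ⟨l', hl', rfl⟩ := hS.1 hc
  have hperm : l'.Perm l := (List.perm_ext_iff_of_nodup hl'.1 hl.1).2 fun e => by
    rw [hl'.2, hl.2]
  rw [hU hl', card_visitors hacyc hl'.1 (fun e => (hl'.2 e).1), hperm.countP_eq]

lemma ncard_orderingProducts (hG : G.IsAcyclic) {l : List (Sym2 (Fin n))}
    (hl : IsEdgeOrdering G l) :
    (orderingProducts G).ncard = ∏ i, (l.countP (i ∈ ·)).factorial := by
  induction hm : l.length generalizing G l with
  | zero =>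
    obtain rfl := List.length_eq_zero_iff.1 hm
    have : orderingProducts G = {1} := by
      ext c
      constructor
      · rintro ⟨l', hl', rfl⟩
        have : l' = [] := List.eq_nil_iff_forall_not_mem.2 fun e he => by
          rw [hl'.2, ← hl.2] at he
          simp at he
        simp [this]
      · rintro rfl
        exact ⟨[], hl, rfl⟩
    simp [this]
  | succ m ih =>
    obtain ⟨u, v, huv, hleaf⟩ := exists_leaf hG <| by
      obtain ⟨e, he⟩ := List.exists_mem_of_length_pos (l := l) (by omega)
      exact ⟨e, (hl.2 e).1 he⟩
    obtain ⟨l₁, l₂, rfl⟩ := List.append_of_mem ((hl.2 s(u, v)).2 huv)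
    have hdel := hl.deleteEdges
    rw [ncard_orderingProducts_of_leaf hG huv hleaf hdel,
      ih (hG.anti (deleteEdges_le _)) hdel (by simp at hm ⊢; omega)]
    have hcount : (l₁ ++ l₂).countP (u ∈ ·) = 0 := by
      rw [List.countP_eq_zero]
      intro e he hue
      rw [hdel.2, edgeSet_deleteEdges, Set.mem_sdiff, Set.mem_singleton_iff] at he
      obtain ⟨w, rfl⟩ := of_decide_eq_true hue
      exact he.2 (by rw [hleaf w he.1])
    have hfactor (i : Fin n) : ((l₁ ++ s(u, v) :: l₂).countP (i ∈ ·)).factorial =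
        ((l₁ ++ l₂).countP (i ∈ ·)).factorial *
          if i = v then (l₁ ++ l₂).countP (v ∈ ·) + 1 else 1 := by
      rw [List.perm_middle.countP_eq, List.countP_cons]
      by_cases hiv : i = v
      · subst hiv
        simp [Nat.factorial_succ, mul_comm]
      · by_cases hiu : i = u
        · subst hiu
          simp [hcount, hiv]
        · simp [hiv, hiu]
    simp_rw [hfactor, Finset.prod_mul_distrib]
    simp

lemma IsEdgeOrdering.countP_eq_degree [DecidableRel G.Adj] {l : List (Sym2 (Fin n))}
    (hl : IsEdgeOrdering G l) (i : Fin n) : l.countP (i ∈ ·) = G.degree i := by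
  classical
  rw [← card_incidenceFinset_eq_degree, List.countP_eq_length_filter,
    ← List.toFinset_card_of_nodup (hl.1.filter _)]
  congr 1
  ext e
  simp [hl.2, incidenceSet]

lemma exists_isEdgeOrdering (G : SimpleGraph (Fin n)) : ∃ l, IsEdgeOrdering G l := by
  classical
  exact ⟨G.edgeFinset.toList, G.edgeFinset.nodup_toList, fun e => by simp⟩

end EdgeOrderings

/-- Theorem 2.3: the number of distinct permutations arising as products
of edge orderings of a tree `T` equals the product of the factorials of the vertex
degrees. -/
theorem stmt2 (n : ℕ) (T : SimpleGraph (Fin n)) [DecidableRel T.Adj] (hT : T.IsTree) :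
    {c : Equiv.Perm (Fin n) | ∃ l, IsEdgeOrdering T l ∧ listProd l = c}.ncard
      = ∏ i : Fin n, Nat.factorial (T.degree i) := by
  obtain ⟨l, hl⟩ := exists_isEdgeOrdering T
  simp_rw [← hl.countP_eq_degree]
  exact ncard_orderingProducts hT.isAcyclic hl
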